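/- (Dimension 56 case of the main theorem.) Define P₅₆(z) = (1 − z)⁷ − (105/16)(1 − z)⁴ z² + (21735/4096)(1 − z) z⁴. For every real y > 0, P₅₆(z(y)) ≥ P₅₆(1/4) > 0; consequently the secrecy function Ξ(y) = P₅₆(z(y))^{-1} of the extremal even unimodular lattice in dimension 56 satisfies Ξ(y) ≤ Ξ(1) = P₅₆(1/4)^{-1}. -/

import Mathlib

/-- Jacobi theta constant θ₂ on the imaginary axis. -/
noncomputable def theta2 (y : ℝ) : ℝ := ∑' n : ℤ, Real.exp (-Real.pi * y * (n + 1/2)^2)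

/-- Jacobi theta constant θ₃ on the imaginary axis. -/
noncomputable def theta3 (y : ℝ) : ℝ := ∑' n : ℤ, Real.exp (-Real.pi * y * n^2)

/-- Jacobi theta constant θ₄ on the imaginary axis. -/
noncomputable def theta4 (y : ℝ) : ℝ := ∑' n : ℤ, (-1 : ℝ)^n * Real.exp (-Real.pi * y * n^2)

/-- The function z(y) = θ₂(y)⁴θ₄(y)⁴/θ₃(y)⁸. -/
noncomputable def zfun (y : ℝ) : ℝ := theta2 y ^ 4 * theta4 y ^ 4 / theta3 y ^ 8

/-- Denominator polynomial of the secrecy function of the extremal even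
unimodular lattice in dimension 56. -/
noncomputable def P56 (z : ℝ) : ℝ := (1 - z) ^ 7 - 105 / 16 * (1 - z) ^ 4 * z ^ 2 + 21735 / 4096 * (1 - z) * z ^ 4

open Real HurwitzZeta

/-- The decomposition of `ℤ × ℤ` into pairs with even and odd coordinate sum, each parametrised
by `ℤ × ℤ`. -/
noncomputable def intProdParityEquiv : (ℤ × ℤ) ⊕ (ℤ × ℤ) ≃ ℤ × ℤ :=
  Equiv.ofBijective
    (Sum.elim (fun p ↦ (p.1 + p.2, p.1 - p.2)) (fun p ↦ (p.1 + p.2 + 1, p.1 - p.2))) <| by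
    constructor
    · rintro (⟨a, b⟩ | ⟨a, b⟩) (⟨c, d⟩ | ⟨c, d⟩) h <;>
        simp only [Sum.elim_inl, Sum.elim_inr, Prod.mk.injEq, Sum.inl.injEq, Sum.inr.injEq,
          reduceCtorEq] at h ⊢ <;> omega
    · rintro ⟨a, b⟩
      rcases Int.even_or_odd' (a + b) with ⟨k, hk | hk⟩
      · exact ⟨.inl (k, k - b), by simp; omega⟩
      · exact ⟨.inr (k, k - b), by simp; omega⟩

theorem tsum_int_prod_parity {f : ℤ × ℤ → ℝ} (hf : Summable f) :
    ∑' p, f p = ∑' p : ℤ × ℤ, f (p.1 + p.2, p.1 - p.2) +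
      ∑' p : ℤ × ℤ, f (p.1 + p.2 + 1, p.1 - p.2) := by
  have hs : Summable (f ∘ intProdParityEquiv) := intProdParityEquiv.summable_iff.2 hf
  rw [← intProdParityEquiv.tsum_eq f]
  exact Summable.tsum_sum (f := f ∘ intProdParityEquiv)
    (hs.comp_injective Sum.inl_injective) (hs.comp_injective Sum.inr_injective)

section Summability

variable {y : ℝ}

theorem hasSum_theta2 (hy : 0 < y) :
    HasSum (fun n : ℤ ↦ exp (-π * y * (n + 1 / 2) ^ 2)) (evenKernel (1 / 2 : ℝ) y) := by
  convert hasSum_int_evenKernel (1 / 2) hy using 3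
  ring

theorem hasSum_theta3 (hy : 0 < y) :
    HasSum (fun n : ℤ ↦ exp (-π * y * n ^ 2)) (evenKernel (0 : ℝ) y) := by
  convert hasSum_int_evenKernel 0 hy using 3
  ring

theorem hasSum_theta4 (hy : 0 < y) :
    HasSum (fun n : ℤ ↦ (-1 : ℝ) ^ n * exp (-π * y * n ^ 2)) (cosKernel (1 / 2 : ℝ) y) := by
  rw [← Complex.hasSum_ofReal]
  convert hasSum_int_cosKernel (1 / 2) hy using 2 with n
  have h : Complex.exp (2 * π * Complex.I * (1 / 2 : ℝ) * n) = (-1) ^ n := by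
    rw [← Complex.exp_pi_mul_I, ← Complex.exp_int_mul]
    push_cast
    ring_nf
  rw [h]
  push_cast
  ring_nf

theorem summable_norm_theta2 (hy : 0 < y) :
    Summable fun n : ℤ ↦ ‖exp (-π * y * (n + 1 / 2) ^ 2)‖ :=
  (hasSum_theta2 hy).summable.norm

theorem summable_norm_theta3 (hy : 0 < y) : Summable fun n : ℤ ↦ ‖exp (-π * y * n ^ 2)‖ :=
  (hasSum_theta3 hy).summable.norm

theorem summable_norm_theta4 (hy : 0 < y) :
    Summable fun n : ℤ ↦ ‖(-1 : ℝ) ^ n * exp (-π * y * n ^ 2)‖ :=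
  (hasSum_theta4 hy).summable.norm

end Summability

section Duplication

variable {y : ℝ}

theorem theta3_sq (hy : 0 < y) : theta3 y ^ 2 = theta3 (2 * y) ^ 2 + theta2 (2 * y) ^ 2 := by
  have h3 := summable_norm_theta3 hy
  have h3' := summable_norm_theta3 (y := 2 * y) (by positivity)
  have h2' := summable_norm_theta2 (y := 2 * y) (by positivity)
  simp only [theta3, theta2, sq (tsum _)]
  rw [tsum_mul_tsum_of_summable_norm h3 h3, tsum_mul_tsum_of_summable_norm h3' h3',
    tsum_mul_tsum_of_summable_norm h2' h2',
    tsum_int_prod_parity (summable_mul_of_summable_norm h3 h3)]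
  congr 1 <;> refine tsum_congr fun p ↦ ?_ <;> simp only [← exp_add] <;> push_cast <;> ring_nf

theorem theta4_sq (hy : 0 < y) : theta4 y ^ 2 = theta3 (2 * y) ^ 2 - theta2 (2 * y) ^ 2 := by
  have h4 := summable_norm_theta4 hy
  have h3' := summable_norm_theta3 (y := 2 * y) (by positivity)
  have h2' := summable_norm_theta2 (y := 2 * y) (by positivity)
  simp only [theta4, theta3, theta2, sq (tsum _)]
  rw [tsum_mul_tsum_of_summable_norm h4 h4, tsum_mul_tsum_of_summable_norm h3' h3',
    tsum_mul_tsum_of_summable_norm h2' h2',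
    tsum_int_prod_parity (summable_mul_of_summable_norm h4 h4), sub_eq_add_neg, ← tsum_neg]
  congr 1 <;> refine tsum_congr fun p ↦ ?_
  · rw [mul_mul_mul_comm, ← zpow_add₀ (by norm_num), ← exp_add, ← exp_add,
      Even.neg_one_zpow ⟨p.1, by ring⟩]
    push_cast
    ring_nf
  · rw [mul_mul_mul_comm, ← zpow_add₀ (by norm_num), ← exp_add, ← exp_add,
      Odd.neg_one_zpow ⟨p.1, by ring⟩]
    push_cast
    ring_nf

theorem theta2_sq (hy : 0 < y) : theta2 y ^ 2 = 2 * (theta2 (2 * y) * theta3 (2 * y)) := by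
  have h2 := summable_norm_theta2 hy
  have h3' := summable_norm_theta3 (y := 2 * y) (by positivity)
  have h2' := summable_norm_theta2 (y := 2 * y) (by positivity)
  have hc : 2 * (theta2 (2 * y) * theta3 (2 * y)) =
      theta2 (2 * y) * theta3 (2 * y) + theta3 (2 * y) * theta2 (2 * y) := by ring
  rw [hc]
  simp only [theta3, theta2, sq (tsum _)]
  rw [tsum_mul_tsum_of_summable_norm h2 h2, tsum_mul_tsum_of_summable_norm h2' h3',
    tsum_mul_tsum_of_summable_norm h3' h2',
    tsum_int_prod_parity (summable_mul_of_summable_norm h2 h2)]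
  congr 1
  · refine tsum_congr fun p ↦ ?_
    simp only [← exp_add]
    push_cast
    ring_nf
  · rw [← ((Equiv.addRight (1 : ℤ)).prodCongr (Equiv.refl ℤ)).tsum_eq
      fun p : ℤ × ℤ ↦ exp (-π * (2 * y) * p.1 ^ 2) * exp (-π * (2 * y) * (p.2 + 1 / 2) ^ 2)]
    refine tsum_congr fun p ↦ ?_
    simp only [← exp_add, Equiv.prodCongr_apply, Prod.map, Equiv.coe_addRight, Equiv.refl_apply]
    push_cast
    ring_nf

/-- Jacobi's quartic identity. -/
theorem theta2_pow_four_add_theta4_pow_four (hy : 0 < y) :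
    theta2 y ^ 4 + theta4 y ^ 4 = theta3 y ^ 4 := by
  linear_combination (theta2 y ^ 2 + 2 * (theta2 (2 * y) * theta3 (2 * y))) * theta2_sq hy +
    (theta4 y ^ 2 + theta3 (2 * y) ^ 2 - theta2 (2 * y) ^ 2) * theta4_sq hy -
    (theta3 y ^ 2 + theta3 (2 * y) ^ 2 + theta2 (2 * y) ^ 2) * theta3_sq hy

end Duplication

theorem theta3_pos {y : ℝ} (hy : 0 < y) : 0 < theta3 y :=
  (hasSum_theta3 hy).summable.tsum_pos (fun _ ↦ (exp_pos _).le) 0 (exp_pos _)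

theorem theta2_one_eq_theta4_one : theta2 1 = theta4 1 := by
  rw [theta2, theta4, (hasSum_theta2 one_pos).tsum_eq, (hasSum_theta4 one_pos).tsum_eq,
    evenKernel_functional_equation]
  simp

theorem zfun_nonneg (y : ℝ) : 0 ≤ zfun y := by
  unfold zfun
  positivity

theorem zfun_le {y : ℝ} (hy : 0 < y) : zfun y ≤ 1 / 4 := by
  have h3 := theta3_pos hy
  rw [zfun, div_le_iff₀ (by positivity), show theta3 y ^ 8 = (theta3 y ^ 4) ^ 2 by ring,
    ← theta2_pow_four_add_theta4_pow_four hy]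
  linarith [sq_nonneg (theta2 y ^ 4 - theta4 y ^ 4)]

theorem zfun_one : zfun 1 = 1 / 4 := by
  have h3 := theta3_pos one_pos
  have h := theta2_pow_four_add_theta4_pow_four one_pos
  rw [zfun, div_eq_iff (by positivity), show theta3 1 ^ 8 = (theta3 1 ^ 4) ^ 2 by ring, ← h,
    theta2_one_eq_theta4_one]
  ring

theorem P56_quarter_pos : 0 < P56 (1 / 4) := by
  norm_num [P56]

theorem P56_quarter_le {z : ℝ} (h0 : 0 ≤ z) (h1 : z ≤ 1 / 4) : P56 (1 / 4) ≤ P56 z := by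
  obtain ⟨t, rfl⟩ : ∃ t, z = 1 / 4 - t := ⟨1 / 4 - z, by ring⟩
  have ht : 0 ≤ t := by linarith
  have ht' : 0 ≤ 1 / 4 - t := h0
  have key : P56 (1 / 4 - t) - P56 (1 / 4) = 1430163 / 1048576 * t + 1077489 / 131072 * t ^ 2 +
      257355 / 32768 * t ^ 3 + 11865 / 16384 * t ^ 4 + 1575 / 4096 * t ^ 5 +
      21 / 16 * t ^ 5 * (1 / 4 - t) + t ^ 7 := by
    unfold P56
    ring
  have : 0 ≤ P56 (1 / 4 - t) - P56 (1 / 4) := by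
    rw [key]
    positivity
  linarith

theorem secrecy_dim56 :
    (∀ y : ℝ, 0 < y → P56 (1 / 4) ≤ P56 (zfun y)) ∧ 0 < P56 (1 / 4) ∧
      (∀ y : ℝ, 0 < y → (P56 (zfun y))⁻¹ ≤ (P56 (zfun 1))⁻¹) ∧
      (P56 (zfun 1))⁻¹ = (P56 (1 / 4))⁻¹ := by
  have h (y : ℝ) (hy : 0 < y) : P56 (1 / 4) ≤ P56 (zfun y) :=
    P56_quarter_le (zfun_nonneg y) (zfun_le hy)
  rw [zfun_one]
  exact ⟨h, P56_quarter_pos, fun y hy ↦ inv_anti₀ P56_quarter_pos (h y hy), rfl⟩
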